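/- (Interpolation inequality for the traded factor) Let B, d, K, T be natural numbers with K ≥ 1, K + T ≤ B − d, and set t = T/(B−d−K) (with t = 0 when T = 0). Then H(B−d) − H(K+T) ≤ (1 − t)·(H(B−d) − H(K)) ≤ H(B−d−T) − H(K). -/

import Mathlib

/-- The `n`-th harmonic number `H(n) = ∑_{k=1}^n 1/k` (with `H(0) = 0`). -/
noncomputable def H (n : ℕ) : ℝ := ∑ k ∈ Finset.Icc 1 n, (1 : ℝ) / k

theorem H_succ (n : ℕ) : H (n + 1) = H n + 1 / ((n : ℝ) + 1) := by
  simp [H, Finset.sum_Icc_succ_top]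

theorem div_le_H_add_sub_H {c : ℕ} (a n : ℕ) (h : a + n ≤ c) :
    (n : ℝ) / c ≤ H (a + n) - H a := by
  induction n with
  | zero => simp
  | succ n ih =>
    have hc : ((a + n : ℕ) : ℝ) + 1 ≤ c := by exact_mod_cast h
    have hinv : 1 / (c : ℝ) ≤ 1 / (((a + n : ℕ) : ℝ) + 1) :=
      one_div_le_one_div_of_le (by positivity) hc
    have := ih (by omega)
    rw [← add_assoc, H_succ, Nat.cast_succ, add_div]
    linarith

theorem H_add_sub_H_le_div {b : ℕ} (hb : 0 < b) (m : ℕ) :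
    H (b + m) - H b ≤ (m : ℝ) / b := by
  induction m with
  | zero => simp
  | succ m ih =>
    have hc : (b : ℝ) ≤ ((b + m : ℕ) : ℝ) + 1 := by
      exact_mod_cast (by omega : b ≤ b + m + 1)
    have hinv : 1 / (((b + m : ℕ) : ℝ) + 1) ≤ 1 / (b : ℝ) :=
      one_div_le_one_div_of_le (by exact_mod_cast hb) hc
    rw [← add_assoc, H_succ, Nat.cast_succ, add_div]
    linarith

/-- Discrete concavity of the harmonic numbers: mean increments decrease. -/
theorem mul_H_sub_H_le_mul_H_sub_H {a : ℕ} (ha : 0 < a) (n m : ℕ) :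
    (n : ℝ) * (H (a + n + m) - H (a + n)) ≤ m * (H (a + n) - H a) :=
  calc (n : ℝ) * (H (a + n + m) - H (a + n))
      ≤ n * ((m : ℝ) / (a + n : ℕ)) := by
        gcongr
        exact H_add_sub_H_le_div (by omega) m
    _ = m * ((n : ℝ) / (a + n : ℕ)) := by ring
    _ ≤ m * (H (a + n) - H a) := by
        gcongr
        exact div_le_H_add_sub_H a n le_rfl

/-- (Interpolation inequality for the traded factor) With `t = T/(B−d−K)`, the
random-trading mean `(1−t)·(H(B−d) − H(K))` lies between the best-case bound
`H(B−d) − H(K+T)` and the worst-case bound `H(B−d−T) − H(K)`. -/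
theorem interpolation_traded_factor (B d K T : ℕ) (hK : 1 ≤ K) (h : K + T ≤ B - d)
    (t : ℝ) (ht : t = (T : ℝ) / ((B - d - K : ℕ) : ℝ)) :
    H (B - d) - H (K + T) ≤ (1 - t) * (H (B - d) - H K) ∧
    (1 - t) * (H (B - d) - H K) ≤ H (B - d - T) - H K := by
  obtain ⟨s, hs⟩ := Nat.exists_eq_add_of_le h
  rw [hs, show K + T + s - K = T + s by omega] at ht
  rw [hs, show K + T + s - T = K + s by omega]
  rcases Nat.eq_zero_or_pos T with rfl | hT
  · simp [ht]
  have hpos : (0 : ℝ) < T + s := by positivity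
  have ht' : 1 - t = s / (T + s) := by
    rw [ht]
    push_cast
    field_simp
    ring
  have best := mul_H_sub_H_le_mul_H_sub_H hK T s
  have worst := mul_H_sub_H_le_mul_H_sub_H hK s T
  rw [add_right_comm] at worst
  rw [ht', div_mul_eq_mul_div, le_div_iff₀ hpos, div_le_iff₀ hpos]
  constructor <;> linarith
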